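/- Let B = diag(1,−1) act on row vectors by v ↦ v·B. Let 0 < θ < π/4 and let q be an action minimizer of A over P(Q_S, Q_{E₁}) such that q is continuously differentiable on [0,1], is a classical solution of the Newtonian equations on (0,1), and has no collision at t = 1. Define the extended path q̄ on [0,2] by q̄(t) = q(t) for t ∈ [0,1], and for t ∈ [1,2]: q̄₁(t) = −q₄(2−t)·B·R(2θ), q̄₂(t) = −q₃(2−t)·B·R(2θ), q̄₃(t) = −q₂(2−t)·B·R(2θ), q̄₄(t) = −q₁(2−t)·B·R(2θ). Then q̄ is a classical (twice continuously differentiable, collision-free) solution of the Newtonian equations on (0,2). Similarly, if q̃ is an action minimizer over P(Q_S, Q_{E₂}) with the same regularity hypotheses and no collision at t = 1, the extension defined for t ∈ [1,2] by q̄₁(t) = q̃₂(2−t)·B·R(2θ), q̄₂(t) = q̃₁(2−t)·B·R(2θ), q̄₃(t) = q̃₄(2−t)·B·R(2θ), q̄₄(t) = q̃₃(2−t)·B·R(2θ) yields a classical solution of the Newtonian equations on (0,2). -/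

import Mathlib

open Real MeasureTheory Set
open scoped ENNReal

noncomputable section

/-- Euclidean norm on `ℝ × ℝ` (row vectors in the plane). -/
def enorm2 (v : ℝ × ℝ) : ℝ := Real.sqrt (v.1 ^ 2 + v.2 ^ 2)

/-- Row vector multiplied on the right by the rotation matrix `R θ`
with rows `(cos θ, sin θ)` and `(-sin θ, cos θ)`. -/
def rotV (θ : ℝ) (v : ℝ × ℝ) : ℝ × ℝ :=
  (v.1 * Real.cos θ - v.2 * Real.sin θ, v.1 * Real.sin θ + v.2 * Real.cos θ)

/-- `H¹([0,1],(ℝ²)⁴)`: absolutely continuous paths `[0,1] → (ℝ²)⁴` with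
square-integrable derivative, recorded via an integrable (a.e.-)derivative `v`
together with the integral representation of `q`. -/
structure H1Path4 where
  q : ℝ → Fin 4 → ℝ × ℝ
  v : ℝ → Fin 4 → ℝ × ℝ
  hvInt : ∀ i : Fin 4, IntegrableOn (fun t => v t i) (Icc (0:ℝ) 1)
  hrep : ∀ i : Fin 4, ∀ t ∈ Icc (0:ℝ) 1, q t i = q 0 i + ∫ s in (0:ℝ)..t, v s i
  hL2 : ∀ i : Fin 4, IntegrableOn (fun t => enorm2 (v t i) ^ 2) (Icc (0:ℝ) 1)

/-- Center of mass at the origin throughout `[0,1]` (the path lies in `χ`). -/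
def H1Path4.inChi (p : H1Path4) : Prop := ∀ t ∈ Icc (0:ℝ) 1, ∑ i, p.q t i = 0

/-- The Lagrangian action functional `A`, with value `+∞` allowed. -/
def action (p : H1Path4) : ℝ≥0∞ :=
  ∫⁻ t in Icc (0:ℝ) 1,
    (ENNReal.ofReal ((1/2) * ∑ i, enorm2 (p.v t i) ^ 2)
      + ∑ i : Fin 4, ∑ j ∈ Finset.univ.filter (fun j => i < j),
          (ENNReal.ofReal (enorm2 (p.q t i - p.q t j)))⁻¹)

/-- The starting boundary configuration set `Q_S` (double isosceles with order
constraints). -/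
def QSset : Set (Fin 4 → ℝ × ℝ) :=
  { c | ∃ a₁ b₁ c₁ : ℝ, 0 ≤ b₁ ∧ 0 ≤ c₁ ∧
      c = ![(-a₁ - c₁, 0), (-a₁, 0), ((2*a₁ + c₁)/2, b₁), ((2*a₁ + c₁)/2, -b₁)] }

/-- The ending boundary configuration set `Q_{E₁}`. -/
def QE1set (θ : ℝ) : Set (Fin 4 → ℝ × ℝ) :=
  { c | ∃ a₂ b₂ c₂ : ℝ, 0 ≤ b₂ ∧ 0 ≤ c₂ ∧
      c = fun i => rotV θ (![(-b₂, -a₂), (-c₂, a₂), (c₂, a₂), (b₂, -a₂)] i) }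

/-- The ending boundary configuration set `Q_{E₂}`. -/
def QE2set (θ : ℝ) : Set (Fin 4 → ℝ × ℝ) :=
  { c | ∃ a₂ b₂ c₂ : ℝ, 0 ≤ b₂ ∧ 0 ≤ c₂ ∧
      c = fun i => rotV θ (![(-a₂, -b₂), (-a₂, b₂), (a₂, c₂), (a₂, -c₂)] i) }

/-- Membership in the admissible class `P(Q_S, E)`. -/
def inAdm (E : Set (Fin 4 → ℝ × ℝ)) (p : H1Path4) : Prop :=
  p.inChi ∧ p.q 0 ∈ QSset ∧ p.q 1 ∈ E

/-- `p` is an action minimizer over `P(Q_S, E)`. -/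
def isMin (E : Set (Fin 4 → ℝ × ℝ)) (p : H1Path4) : Prop :=
  inAdm E p ∧ ∀ p' : H1Path4, inAdm E p' → action p ≤ action p'

/-- The Newtonian equations of the equal-mass four-body problem, on a set `s`
of times. -/
def newton (Q : ℝ → Fin 4 → ℝ × ℝ) (s : Set ℝ) : Prop :=
  ∀ i : Fin 4, ∀ t ∈ s,
    deriv (deriv (fun u => Q u i)) t =
      ∑ j ∈ Finset.univ.erase i, (1 / enorm2 (Q t j - Q t i) ^ 3) • (Q t j - Q t i)

/-- Configurations of four bodies in the plane. -/
abbrev Cfg := Fin 4 → ℝ × ℝ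

/-- The Euclidean inner product on configurations. -/
def dot (x y : Cfg) : ℝ := ∑ i, ((x i).1 * (y i).1 + (x i).2 * (y i).2)

/-- The Newtonian potential `∑_{i<j} 1 / |xᵢ - xⱼ|`. -/
def pot (x : Cfg) : ℝ :=
  ∑ i : Fin 4, ∑ j ∈ Finset.univ.filter (fun j => i < j), (enorm2 (x i - x j))⁻¹

/-- The Newtonian force field. -/
def force (x : Cfg) : Cfg := fun i =>
  ∑ j ∈ Finset.univ.erase i, (1 / enorm2 (x j - x i) ^ 3) • (x j - x i)

/-- No two bodies coincide. -/
def CollisionFree (x : Cfg) : Prop := ∀ i j : Fin 4, i ≠ j → x i ≠ x j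

lemma enorm2_nonneg (v : ℝ × ℝ) : 0 ≤ enorm2 v := Real.sqrt_nonneg _

lemma enorm2_sq (v : ℝ × ℝ) : enorm2 v ^ 2 = v.1 ^ 2 + v.2 ^ 2 :=
  Real.sq_sqrt (by positivity)

lemma enorm2_pos {v : ℝ × ℝ} (hv : v ≠ 0) : 0 < enorm2 v := by
  refine Real.sqrt_pos.2 (lt_of_le_of_ne (by positivity) fun h => hv ?_)
  have h1 : v.1 = 0 := by nlinarith [sq_nonneg v.1, sq_nonneg v.2]
  have h2 : v.2 = 0 := by nlinarith [sq_nonneg v.1, sq_nonneg v.2]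
  exact Prod.ext h1 h2

lemma enorm2_sub_comm (v w : ℝ × ℝ) : enorm2 (v - w) = enorm2 (w - v) := by
  unfold enorm2
  congr 1
  simp only [Prod.fst_sub, Prod.snd_sub]
  ring

lemma continuous_enorm2 : Continuous enorm2 := by
  unfold enorm2
  fun_prop

lemma enorm2_le_two_mul_norm (v : ℝ × ℝ) : enorm2 v ≤ 2 * ‖v‖ := by
  have h1 : v.1 ^ 2 ≤ ‖v‖ ^ 2 := by
    rw [← sq_abs, ← Real.norm_eq_abs]
    exact pow_le_pow_left₀ (norm_nonneg _) (norm_fst_le v) 2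
  have h2 : v.2 ^ 2 ≤ ‖v‖ ^ 2 := by
    rw [← sq_abs, ← Real.norm_eq_abs]
    exact pow_le_pow_left₀ (norm_nonneg _) (norm_snd_le v) 2
  refine Real.sqrt_le_iff.2 ⟨by positivity, by nlinarith⟩

lemma dot_self (x : Cfg) : dot x x = ∑ i, enorm2 (x i) ^ 2 := by
  simp only [dot, enorm2_sq]
  simp only [sq]

lemma dot_self_nonneg (x : Cfg) : 0 ≤ dot x x := by
  rw [dot_self]
  positivity

lemma eq_zero_of_dot_self {x : Cfg} (h : dot x x = 0) : x = 0 := by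
  rw [dot_self, Finset.sum_eq_zero_iff_of_nonneg fun i _ => by positivity] at h
  funext i
  by_contra hi
  exact (pow_pos (enorm2_pos hi) 2).ne' (h i (Finset.mem_univ i))

lemma dot_add_left (x y z : Cfg) : dot (x + y) z = dot x z + dot y z := by
  simp only [dot, Fin.sum_univ_four, Pi.add_apply, Prod.fst_add, Prod.snd_add]
  ring

lemma dot_smul_left (c : ℝ) (x z : Cfg) : dot (c • x) z = c * dot x z := by
  simp only [dot, Fin.sum_univ_four, Pi.smul_apply, Prod.smul_fst, Prod.smul_snd, smul_eq_mul]
  ring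

lemma dot_comm (x y : Cfg) : dot x y = dot y x := by
  simp only [dot, mul_comm]

/-- `dot` in its first argument, as a continuous linear map. -/
def dotL (z : Cfg) : Cfg →L[ℝ] ℝ :=
  LinearMap.toContinuousLinearMap
    { toFun := fun x => dot x z
      map_add' := fun x y => dot_add_left x y z
      map_smul' := fun c x => dot_smul_left c x z }

lemma dotL_apply (z x : Cfg) : dotL z x = dot x z := rfl

lemma continuous_dot : Continuous fun z : Cfg × Cfg => dot z.1 z.2 := by
  unfold dot
  fun_prop

lemma HasDerivAt.dot {x y : ℝ → Cfg} {x' y' : Cfg} {t : ℝ} (hx : HasDerivAt x x' t)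
    (hy : HasDerivAt y y' t) :
    HasDerivAt (fun s => dot (x s) (y s)) (dot x' (y t) + dot (x t) y') t := by
  have hx1 : ∀ i, HasDerivAt (fun s => (x s i).1) (x' i).1 t := fun i =>
    ((hasDerivAt_pi.1 hx i).fst)
  have hx2 : ∀ i, HasDerivAt (fun s => (x s i).2) (x' i).2 t := fun i =>
    ((hasDerivAt_pi.1 hx i).snd)
  have hy1 : ∀ i, HasDerivAt (fun s => (y s i).1) (y' i).1 t := fun i =>
    ((hasDerivAt_pi.1 hy i).fst)
  have hy2 : ∀ i, HasDerivAt (fun s => (y s i).2) (y' i).2 t := fun i =>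
    ((hasDerivAt_pi.1 hy i).snd)
  have h := HasDerivAt.fun_sum (u := (Finset.univ : Finset (Fin 4))) fun i _ =>
    ((hx1 i).mul (hy1 i)).add ((hx2 i).mul (hy2 i))
  refine h.congr_deriv ?_
  simp only [_root_.dot, ← Finset.sum_add_distrib]
  exact Finset.sum_congr rfl fun i _ => by ring

/-- The sum of the positions of the four bodies. -/
def total : Cfg →L[ℝ] ℝ × ℝ := ∑ i, ContinuousLinearMap.proj i

lemma total_apply (x : Cfg) : total x = ∑ i, x i := by
  simp [total]

lemma erase_univ_four (i : Fin 4) (f : Fin 4 → ℝ × ℝ) (hf : f i = 0) :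
    ∑ j ∈ Finset.univ.erase i, f j = ∑ j, f j := by
  rw [← Finset.add_sum_erase _ _ (Finset.mem_univ i), hf, zero_add]

lemma force_apply (x : Cfg) (i : Fin 4) :
    force x i = ∑ j, (1 / enorm2 (x j - x i) ^ 3) • (x j - x i) :=
  erase_univ_four i _ (by simp)

lemma total_force (x : Cfg) : total (force x) = 0 := by
  have h : total (force x) = -total (force x) := by
    conv_lhs => rw [total_apply]
    simp only [force_apply]
    rw [Finset.sum_comm, total_apply, ← Finset.sum_neg_distrib]
    refine Finset.sum_congr rfl fun i _ => ?_
    rw [force_apply, ← Finset.sum_neg_distrib]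
    refine Finset.sum_congr rfl fun j _ => ?_
    rw [enorm2_sub_comm, ← smul_neg, neg_sub]
  exact self_eq_neg.1 h

lemma sum_filter_lt_four {M : Type*} [AddCommMonoid M] (f : Fin 4 → Fin 4 → M) :
    ∑ i : Fin 4, ∑ j ∈ Finset.univ.filter (fun j => i < j), f i j =
      f 0 1 + f 0 2 + f 0 3 + f 1 2 + f 1 3 + f 2 3 := by
  simp only [Finset.sum_filter, Fin.sum_univ_four]
  simp [Fin.lt_def, add_assoc]

lemma hasDerivAt_inv_enorm2 {a b : ℝ × ℝ} {ε : ℝ} (h : a + ε • b ≠ 0) :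
    HasDerivAt (fun s : ℝ => (enorm2 (a + s • b))⁻¹)
      (-(1 / enorm2 (a + ε • b) ^ 3) *
        ((a + ε • b).1 * b.1 + (a + ε • b).2 * b.2)) ε := by
  have hpos := enorm2_pos h
  have hsq := enorm2_sq (a + ε • b)
  have h1 : HasDerivAt (fun s : ℝ => (a + s • b).1 ^ 2 + (a + s • b).2 ^ 2)
      (2 * ((a + ε • b).1 * b.1 + (a + ε • b).2 * b.2)) ε := by
    simp only [Prod.fst_add, Prod.snd_add, Prod.smul_fst, Prod.smul_snd, smul_eq_mul]
    have e1 : HasDerivAt (fun s : ℝ => a.1 + s * b.1) b.1 ε := by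
      simpa using ((hasDerivAt_id ε).mul_const b.1).const_add a.1
    have e2 : HasDerivAt (fun s : ℝ => a.2 + s * b.2) b.2 ε := by
      simpa using ((hasDerivAt_id ε).mul_const b.2).const_add a.2
    refine ((e1.pow 2).add (e2.pow 2)).congr_deriv ?_
    push_cast
    ring
  have h2 := (h1.sqrt (by rw [← hsq]; positivity)).inv hpos.ne'
  refine h2.congr_deriv ?_
  change -(_ / (2 * enorm2 (a + ε • b))) / enorm2 (a + ε • b) ^ 2 = _
  field_simp

lemma hasDerivAt_pot {x y : Cfg} {ε : ℝ} (h : CollisionFree (x + ε • y)) :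
    HasDerivAt (fun s : ℝ => pot (x + s • y)) (dot (force (x + ε • y)) y) ε := by
  have key : ∀ i j : Fin 4, i ≠ j →
      HasDerivAt (fun s : ℝ => (enorm2 ((x + s • y) i - (x + s • y) j))⁻¹)
        (-(1 / enorm2 ((x + ε • y) i - (x + ε • y) j) ^ 3) *
        (((x + ε • y) i - (x + ε • y) j).1 * (y i - y j).1 +
          ((x + ε • y) i - (x + ε • y) j).2 * (y i - y j).2)) ε := by
    intro i j hij
    have e : ∀ s : ℝ, (x + s • y) i - (x + s • y) j = (x i - x j) + s • (y i - y j) := by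
      intro s
      simp only [Pi.add_apply, Pi.smul_apply, smul_sub]
      abel
    simp only [e]
    refine hasDerivAt_inv_enorm2 ?_
    rw [← e]
    exact sub_ne_zero.2 (h i j hij)
  simp only [pot, sum_filter_lt_four]
  have h6 := (((((key 0 1 (by decide)).add (key 0 2 (by decide))).add
    (key 0 3 (by decide))).add (key 1 2 (by decide))).add (key 1 3 (by decide))).add
    (key 2 3 (by decide))
  refine h6.congr_deriv ?_
  generalize x + ε • y = z
  simp only [dot, force_apply, Fin.sum_univ_four, Prod.fst_add, Prod.snd_add, Prod.smul_fst,
    Prod.smul_snd, smul_eq_mul, Prod.fst_sub, Prod.snd_sub]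
  rw [enorm2_sub_comm (z 1) (z 0), enorm2_sub_comm (z 2) (z 0), enorm2_sub_comm (z 3) (z 0),
    enorm2_sub_comm (z 2) (z 1), enorm2_sub_comm (z 3) (z 1), enorm2_sub_comm (z 3) (z 2)]
  ring

lemma continuousOn_pot : ContinuousOn pot {x | CollisionFree x} := by
  unfold pot
  refine continuousOn_finsetSum _ fun i _ => continuousOn_finsetSum _ fun j hj => ?_
  refine ContinuousOn.inv₀ ?_ fun x hx => ?_
  · exact (continuous_enorm2.comp (by fun_prop : Continuous fun x : Cfg => x i - x j)).continuousOn
  · exact (enorm2_pos (sub_ne_zero.2 (hx i j (by simpa using (Finset.mem_filter.1 hj).2.ne)))).ne'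

lemma continuousOn_force : ContinuousOn force {x | CollisionFree x} := by
  rw [continuousOn_pi]
  intro i
  refine continuousOn_finsetSum _ fun j hj => ?_
  refine ContinuousOn.fun_smul (g := fun x : Cfg => x j - x i) ?_ (by fun_prop)
  refine ContinuousOn.div continuousOn_const ?_ fun x hx => ?_
  · exact ((continuous_enorm2.comp
      (by fun_prop : Continuous fun x : Cfg => x j - x i)).pow 3).continuousOn
  · exact (pow_pos (enorm2_pos (sub_ne_zero.2 (hx j i (Finset.ne_of_mem_erase hj)))) 3).ne'

lemma isOpen_collisionFree : IsOpen {x : Cfg | CollisionFree x} := by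
  simp only [CollisionFree, ofPred_forall]
  refine isOpen_iInter_of_finite fun i => isOpen_iInter_of_finite fun j =>
    isOpen_iInter_of_finite fun _ => isOpen_ne_fun (by fun_prop) (by fun_prop)

lemma pot_nonneg (x : Cfg) : 0 ≤ pot x :=
  Finset.sum_nonneg fun _ _ => Finset.sum_nonneg fun _ _ => inv_nonneg.2 (enorm2_nonneg _)

/-- The reflection of the plane with matrix `(α, β; β, -α)`. -/
def planeRefl (α β : ℝ) : (ℝ × ℝ) →L[ℝ] ℝ × ℝ :=
  LinearMap.toContinuousLinearMap
    { toFun := fun v => (α * v.1 + β * v.2, β * v.1 - α * v.2)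
      map_add' := fun v w => by ext <;> simp <;> ring
      map_smul' := fun c v => by ext <;> simp <;> ring }

lemma planeRefl_apply (α β : ℝ) (v : ℝ × ℝ) :
    planeRefl α β v = (α * v.1 + β * v.2, β * v.1 - α * v.2) := rfl

/-- The map on configurations reflecting the plane and relabelling the bodies. -/
def cfgRefl (α β : ℝ) (σ : Fin 4 → Fin 4) : Cfg →L[ℝ] Cfg :=
  ContinuousLinearMap.pi fun i => (planeRefl α β).comp (ContinuousLinearMap.proj (σ i))

lemma cfgRefl_apply (α β : ℝ) (σ : Fin 4 → Fin 4) (x : Cfg) (i : Fin 4) :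
    cfgRefl α β σ x i = planeRefl α β (x (σ i)) := rfl

section Reflection

variable {α β : ℝ} {σ : Fin 4 → Fin 4}

lemma planeRefl_planeRefl (h : α ^ 2 + β ^ 2 = 1) (v : ℝ × ℝ) :
    planeRefl α β (planeRefl α β v) = v := by
  ext <;> simp only [planeRefl_apply]
  · linear_combination v.1 * h
  · linear_combination v.2 * h

lemma enorm2_planeRefl (h : α ^ 2 + β ^ 2 = 1) (v : ℝ × ℝ) :
    enorm2 (planeRefl α β v) = enorm2 v := by
  unfold enorm2
  congr 1
  simp only [planeRefl_apply]
  linear_combination (v.1 ^ 2 + v.2 ^ 2) * h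

lemma cfgRefl_cfgRefl (h : α ^ 2 + β ^ 2 = 1) (hσ : Function.Involutive σ) (x : Cfg) :
    cfgRefl α β σ (cfgRefl α β σ x) = x := by
  funext i
  rw [cfgRefl_apply, cfgRefl_apply, planeRefl_planeRefl h, hσ i]

lemma sum_comp_involutive {M : Type*} [AddCommMonoid M] (hσ : Function.Involutive σ)
    (f : Fin 4 → M) : ∑ i, f (σ i) = ∑ i, f i :=
  Equiv.sum_comp hσ.toPerm f

lemma dot_cfgRefl (h : α ^ 2 + β ^ 2 = 1) (hσ : Function.Involutive σ) (x y : Cfg) :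
    dot (cfgRefl α β σ x) (cfgRefl α β σ y) = dot x y := by
  unfold dot
  rw [← sum_comp_involutive hσ fun i => (x i).1 * (y i).1 + (x i).2 * (y i).2]
  refine Finset.sum_congr rfl fun i _ => ?_
  simp only [cfgRefl_apply, planeRefl_apply]
  linear_combination ((x (σ i)).1 * (y (σ i)).1 + (x (σ i)).2 * (y (σ i)).2) * h

lemma total_cfgRefl (hσ : Function.Involutive σ) (x : Cfg) :
    total (cfgRefl α β σ x) = planeRefl α β (total x) := by
  simp only [total_apply, cfgRefl_apply]
  rw [← map_sum, sum_comp_involutive hσ x]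

lemma force_cfgRefl (h : α ^ 2 + β ^ 2 = 1) (hσ : Function.Involutive σ) (x : Cfg) :
    force (cfgRefl α β σ x) = cfgRefl α β σ (force x) := by
  funext i
  rw [cfgRefl_apply, force_apply, force_apply, map_sum,
    ← sum_comp_involutive hσ
      fun j => planeRefl α β ((1 / enorm2 (x j - x (σ i)) ^ 3) • (x j - x (σ i)))]
  refine Finset.sum_congr rfl fun j _ => ?_
  rw [cfgRefl_apply, cfgRefl_apply, ← map_sub, enorm2_planeRefl h, map_smul]

lemma CollisionFree.cfgRefl (h : α ^ 2 + β ^ 2 = 1) (hσ : Function.Involutive σ) {x : Cfg}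
    (hx : CollisionFree x) : CollisionFree (cfgRefl α β σ x) := by
  intro i j hij heq
  refine hx (σ i) (σ j) (hσ.injective.ne hij) ?_
  rw [← planeRefl_planeRefl h (x (σ i)), ← planeRefl_planeRefl h (x (σ j))]
  exact congrArg _ heq

end Reflection

lemma sum_inv_ofReal_eq_pot {x : Cfg} (hx : CollisionFree x) :
    ∑ i : Fin 4, ∑ j ∈ Finset.univ.filter (fun j => i < j),
      (ENNReal.ofReal (enorm2 (x i - x j)))⁻¹ = ENNReal.ofReal (pot x) := by
  unfold pot
  rw [ENNReal.ofReal_sum_of_nonneg fun i _ =>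
    Finset.sum_nonneg fun _ _ => inv_nonneg.2 (enorm2_nonneg _)]
  refine Finset.sum_congr rfl fun i _ => ?_
  rw [ENNReal.ofReal_sum_of_nonneg fun _ _ => inv_nonneg.2 (enorm2_nonneg _)]
  refine Finset.sum_congr rfl fun j hj => ?_
  rw [ENNReal.ofReal_inv_of_pos]
  exact enorm2_pos (sub_ne_zero.2 (hx i j (Finset.mem_filter.1 hj).2.ne))

lemma continuousOn_lagrangian {q u : ℝ → Cfg} {s : Set ℝ} (hq : ContinuousOn q s)
    (hu : ContinuousOn u s) (hcf : ∀ t ∈ s, CollisionFree (q t)) :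
    ContinuousOn (fun t => 1 / 2 * dot (u t) (u t) + pot (q t)) s :=
  (continuousOn_const.mul (continuous_dot.comp_continuousOn (hu.prodMk hu))).add
    (continuousOn_pot.comp hq hcf)

lemma action_eq_ofReal_integral {p : H1Path4} {q u : ℝ → Cfg}
    (hq : ContinuousOn q (Icc (0 : ℝ) 1)) (hu : ContinuousOn u (Icc (0 : ℝ) 1))
    (hpq : ∀ t ∈ Icc (0 : ℝ) 1, p.q t = q t)
    (hpv : ∀ᵐ t ∂volume.restrict (Icc (0 : ℝ) 1), p.v t = u t)
    (hcf : ∀ t ∈ Icc (0 : ℝ) 1, CollisionFree (q t)) :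
    action p = ENNReal.ofReal (∫ t in (0 : ℝ)..1, (1 / 2 * dot (u t) (u t) + pot (q t))) := by
  rw [intervalIntegral.integral_of_le zero_le_one, ← integral_Icc_eq_integral_Ioc,
    ofReal_integral_eq_lintegral_ofReal
      ((continuousOn_lagrangian hq hu hcf).integrableOn_compact isCompact_Icc)
      (Filter.Eventually.of_forall fun t => add_nonneg
        (mul_nonneg (by norm_num) (dot_self_nonneg _)) (pot_nonneg _))]
  refine lintegral_congr_ae ?_
  filter_upwards [hpv, ae_restrict_mem measurableSet_Icc] with t hv ht
  rw [hpq t ht, hv, sum_inv_ofReal_eq_pot (hcf t ht), ← dot_self,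
    ENNReal.ofReal_add (mul_nonneg (by norm_num) (dot_self_nonneg _)) (pot_nonneg _)]

lemma inv_ofReal_enorm2_le_action_integrand (p : H1Path4) (t : ℝ) {i j : Fin 4} (hij : i < j) :
    (ENNReal.ofReal (enorm2 (p.q t i - p.q t j)))⁻¹ ≤
      ENNReal.ofReal ((1/2) * ∑ i, enorm2 (p.v t i) ^ 2)
      + ∑ i : Fin 4, ∑ j ∈ Finset.univ.filter (fun j => i < j),
          (ENNReal.ofReal (enorm2 (p.q t i - p.q t j)))⁻¹ := by
  refine le_trans ?_ le_add_self
  refine le_trans ?_ (Finset.single_le_sum (f := fun i : Fin 4 =>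
    ∑ j ∈ Finset.univ.filter (fun j => i < j),
      (ENNReal.ofReal (enorm2 (p.q t i - p.q t j)))⁻¹) (fun _ _ => zero_le) (Finset.mem_univ i))
  exact Finset.single_le_sum (f := fun j : Fin 4 =>
      (ENNReal.ofReal (enorm2 (p.q t i - p.q t j)))⁻¹) (fun _ _ => zero_le)
      (Finset.mem_filter.2 ⟨Finset.mem_univ j, hij⟩)

/-- A continuously differentiable path of finite action has no collisions. -/
lemma collisionFree_of_action_ne_top {p : H1Path4} (hreg : ContDiffOn ℝ 1 p.q (Icc (0 : ℝ) 1))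
    (hA : action p ≠ ⊤) : ∀ t ∈ Icc (0 : ℝ) 1, CollisionFree (p.q t) := by
  have key : ∀ t₀ ∈ Icc (0 : ℝ) 1, ∀ i j : Fin 4, i < j → p.q t₀ i ≠ p.q t₀ j := by
    intro t₀ ht₀ i j hij heq
    obtain ⟨K, hK⟩ := (isCompact_Icc (a := (0 : ℝ)) (b := 1)).exists_bound_of_continuousOn
      (hreg.continuousOn_derivWithin (uniqueDiffOn_Icc zero_lt_one) le_rfl)
    have hlip : ∀ t ∈ Icc (0 : ℝ) 1, ‖p.q t - p.q t₀‖ ≤ K * ‖t - t₀‖ := fun t ht =>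
      (convex_Icc 0 1).norm_image_sub_le_of_norm_derivWithin_le
        (hreg.differentiableOn one_ne_zero) hK ht₀ ht
    set C : ℝ := 4 * |K| + 1 with hC
    have hC0 : 0 < C := by positivity
    have hdist : ∀ t ∈ Icc (0 : ℝ) 1, enorm2 (p.q t i - p.q t j) ≤ C * |t - t₀| := by
      intro t ht
      have hK' : K * ‖t - t₀‖ ≤ |K| * |t - t₀| := by
        rw [Real.norm_eq_abs]
        exact mul_le_mul_of_nonneg_right (le_abs_self K) (abs_nonneg _)
      have h1 : ∀ k, ‖p.q t k - p.q t₀ k‖ ≤ |K| * |t - t₀| := fun k =>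
        (norm_le_pi_norm (p.q t - p.q t₀) k).trans ((hlip t ht).trans hK')
      have h2 : ‖p.q t i - p.q t j‖ ≤ 2 * (|K| * |t - t₀|) := by
        have : p.q t i - p.q t j = (p.q t i - p.q t₀ i) - (p.q t j - p.q t₀ j) := by
          rw [heq]; abel
        rw [this]
        exact (norm_sub_le _ _).trans (by linarith [h1 i, h1 j])
      have h3 := enorm2_le_two_mul_norm (p.q t i - p.q t j)
      nlinarith [abs_nonneg (t - t₀)]
    have hfin : ∫⁻ t in Icc (0 : ℝ) 1, ENNReal.ofReal ‖(C * (t - t₀))⁻¹‖ < ⊤ := by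
      refine lt_of_le_of_lt (setLIntegral_mono' measurableSet_Icc fun t ht => ?_)
        (lt_top_iff_ne_top.2 hA)
      refine le_trans ?_ (inv_ofReal_enorm2_le_action_integrand p t hij)
      rcases eq_or_ne t t₀ with rfl | hne
      · simp
      · have hpos : 0 < C * |t - t₀| := mul_pos hC0 (abs_pos.2 (sub_ne_zero.2 hne))
        rw [norm_inv, norm_mul, Real.norm_eq_abs, Real.norm_eq_abs, abs_of_pos hC0,
          ENNReal.ofReal_inv_of_pos hpos]
        exact ENNReal.inv_le_inv.2 (ENNReal.ofReal_le_ofReal (hdist t ht))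
    have hInt : IntegrableOn (fun t => (C * (t - t₀))⁻¹) (Icc (0 : ℝ) 1) :=
      ⟨by fun_prop, hasFiniteIntegral_iff_norm _ |>.2 hfin⟩
    have hInt' : IntervalIntegrable (fun t => (t - t₀)⁻¹) volume 0 1 := by
      rw [intervalIntegrable_iff_integrableOn_Icc_of_le zero_le_one]
      refine (hInt.const_mul C).congr (Filter.Eventually.of_forall fun t => ?_)
      simp only [mul_inv]
      field_simp
    rw [intervalIntegrable_sub_inv_iff, uIcc_of_le zero_le_one] at hInt'
    rcases hInt' with h | h
    · exact zero_ne_one h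
    · exact h ht₀
  intro t ht i j hij
  rcases lt_or_gt_of_ne hij with h | h
  · exact key t ht i j h
  · exact (key t ht j i h).symm

lemma eventually_collisionFree_variation {q ξ : ℝ → Cfg} (hq : Continuous q) (hξ : Continuous ξ)
    (hcf : ∀ t ∈ Icc (0 : ℝ) 1, CollisionFree (q t)) :
    ∀ᶠ ε in nhds (0 : ℝ), ∀ t ∈ Icc (0 : ℝ) 1, CollisionFree (q t + ε • ξ t) := by
  refine isCompact_Icc.eventually_forall_of_forall_eventually fun t ht => ?_
  have hc : Continuous fun z : ℝ × ℝ => q z.2 + z.1 • ξ z.2 := by fun_prop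
  exact hc.continuousAt.preimage_mem_nhds (isOpen_collisionFree.mem_nhds (by simpa using hcf t ht))

/-- The first variation of the action. -/
lemma hasDerivAt_action_variation {q u ξ η : ℝ → Cfg} (hq : Continuous q) (hu : Continuous u)
    (hξ : Continuous ξ) (hη : Continuous η) (hcf : ∀ t ∈ Icc (0 : ℝ) 1, CollisionFree (q t)) :
    HasDerivAt (fun ε : ℝ => ∫ t in (0 : ℝ)..1,
        (1 / 2 * dot (u t + ε • η t) (u t + ε • η t) + pot (q t + ε • ξ t)))
      (∫ t in (0 : ℝ)..1, (dot (u t) (η t) + dot (force (q t)) (ξ t))) 0 := by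
  obtain ⟨δ, hδ, hδcf⟩ := Metric.nhds_basis_closedBall.eventually_iff.1
    (eventually_collisionFree_variation hq hξ hcf)
  have hmem : Metric.closedBall (0 : ℝ) δ ∈ nhds (0 : ℝ) := Metric.closedBall_mem_nhds 0 hδ
  have hF : ∀ ε ∈ Metric.closedBall (0 : ℝ) δ, ContinuousOn (fun t =>
      1 / 2 * dot (u t + ε • η t) (u t + ε • η t) + pot (q t + ε • ξ t)) (uIcc 0 1) := by
    intro ε hε
    rw [uIcc_of_le zero_le_one]
    exact continuousOn_lagrangian (by fun_prop) (by fun_prop) (hδcf hε)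
  let F' : ℝ → ℝ → ℝ := fun ε t =>
    dot (u t + ε • η t) (η t) + dot (force (q t + ε • ξ t)) (ξ t)
  have hF' : ContinuousOn (fun z : ℝ × ℝ => F' z.1 z.2)
      (Metric.closedBall (0 : ℝ) δ ×ˢ Icc (0 : ℝ) 1) := by
    have h1 : Continuous fun z : ℝ × ℝ => (u z.2 + z.1 • η z.2, η z.2) := by fun_prop
    have h2 : ContinuousOn (fun z : ℝ × ℝ => force (q z.2 + z.1 • ξ z.2))
        (Metric.closedBall (0 : ℝ) δ ×ˢ Icc (0 : ℝ) 1) :=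
      continuousOn_force.comp (by fun_prop) fun z hz => hδcf hz.1 z.2 hz.2
    have h3 : Continuous fun z : ℝ × ℝ => ξ z.2 := by fun_prop
    have h4 := (continuous_dot.comp h1).continuousOn (s := Metric.closedBall (0 : ℝ) δ ×ˢ Icc (0 : ℝ) 1)
    have h5 := continuous_dot.comp_continuousOn (h2.prodMk h3.continuousOn)
    exact h4.add h5
  obtain ⟨C, hC⟩ := ((isCompact_closedBall (0 : ℝ) δ).prod
    isCompact_Icc).exists_bound_of_continuousOn hF'
  have hF'0 : ContinuousOn (F' 0) (uIcc 0 1) := by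
    rw [uIcc_of_le zero_le_one]
    exact hF'.comp (f := fun t : ℝ => ((0 : ℝ), t)) (by fun_prop) fun t ht =>
      ⟨Metric.mem_closedBall_self hδ.le, ht⟩
  have hsub : ∀ t, t ∈ uIoc (0 : ℝ) 1 → t ∈ Icc (0 : ℝ) 1 := fun t ht => by
    rw [uIoc_of_le zero_le_one] at ht
    exact Ioc_subset_Icc_self ht
  have h := (intervalIntegral.hasDerivAt_integral_of_dominated_loc_of_deriv_le (F' := F')
    (bound := fun _ => C) (μ := volume) hmem
    (Filter.eventually_of_mem hmem fun ε hε =>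
      (hF ε hε).intervalIntegrable.def'.aestronglyMeasurable)
    ((hF 0 (Metric.mem_closedBall_self hδ.le)).intervalIntegrable)
    hF'0.intervalIntegrable.def'.aestronglyMeasurable
    (Filter.Eventually.of_forall fun t ht ε hε => hC (ε, t) ⟨hε, hsub t ht⟩)
    intervalIntegrable_const
    (Filter.Eventually.of_forall fun t ht ε hε => by
      have hlin : HasDerivAt (fun s : ℝ => u t + s • η t) (η t) ε := by
        simpa using ((hasDerivAt_id ε).smul_const (η t)).const_add (u t)
      refine (((hlin.dot hlin).const_mul (1 / 2)).add
        (hasDerivAt_pot (hδcf hε t (hsub t ht)))).congr_deriv ?_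
      simp only [F']
      rw [dot_comm (η t)]
      ring)).2
  simpa [F'] using h

/-- A continuously differentiable path on `[0,1]` extends to a continuous path whose velocity
extends continuously as well. -/
lemma exists_continuous_velocity {p : H1Path4} (hreg : ContDiffOn ℝ 1 p.q (Icc (0 : ℝ) 1))
    (hchi : p.inChi) :
    ∃ q u : ℝ → Cfg, Continuous q ∧ Continuous u ∧ (∀ t ∈ Icc (0 : ℝ) 1, q t = p.q t) ∧
      (∀ t, ∃ s ∈ Icc (0 : ℝ) 1, q t = p.q s) ∧
      (∀ t ∈ Icc (0 : ℝ) 1, q t = q 0 + ∫ s in (0 : ℝ)..t, u s) ∧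
      (∀ᵐ t ∂volume.restrict (Icc (0 : ℝ) 1), p.v t = u t) ∧ ∀ t, total (u t) = 0 := by
  have h01 : (0 : ℝ) ≤ 1 := zero_le_one
  have hud : UniqueDiffOn ℝ (Icc (0 : ℝ) 1) := uniqueDiffOn_Icc zero_lt_one
  set d : ℝ → Cfg := derivWithin p.q (Icc (0 : ℝ) 1) with hd
  have hdc : ContinuousOn d (Icc (0 : ℝ) 1) := hreg.continuousOn_derivWithin hud le_rfl
  have hderiv : ∀ t ∈ Icc (0 : ℝ) 1, HasDerivWithinAt p.q (d t) (Icc (0 : ℝ) 1) t := fun t ht =>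
    (hreg.differentiableOn one_ne_zero t ht).hasDerivWithinAt
  let q : ℝ → Cfg := IccExtend h01 ((Icc (0 : ℝ) 1).domRestrict p.q)
  let u : ℝ → Cfg := IccExtend h01 ((Icc (0 : ℝ) 1).domRestrict d)
  have hq : Continuous q := hreg.continuousOn.domRestrict.Icc_extend'
  have hu : Continuous u := hdc.domRestrict.Icc_extend'
  have hqp : ∀ t ∈ Icc (0 : ℝ) 1, q t = p.q t := fun t ht => IccExtend_of_mem h01 _ ht
  have hud' : ∀ t ∈ Icc (0 : ℝ) 1, u t = d t := fun t ht => IccExtend_of_mem h01 _ ht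
  have hqu : ∀ t ∈ Icc (0 : ℝ) 1, q t = q 0 + ∫ s in (0 : ℝ)..t, u s := by
    intro t ht
    rw [intervalIntegral.integral_eq_sub_of_hasDerivAt_of_le ht.1 hq.continuousOn (fun s hs => ?_)
      (hu.intervalIntegrable 0 t)]
    · abel
    · have hs' : s ∈ Ioo (0 : ℝ) 1 := ⟨hs.1, hs.2.trans_le ht.2⟩
      have hI : Icc (0 : ℝ) 1 ∈ nhds s := Icc_mem_nhds hs'.1 hs'.2
      rw [hud' s (Ioo_subset_Icc_self hs')]
      exact ((hderiv s (Ioo_subset_Icc_self hs')).hasDerivAt hI).congr_of_eventuallyEq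
        (Filter.eventually_of_mem hI hqp)
  refine ⟨q, u, hq, hu, hqp, fun t => ⟨projIcc 0 1 h01 t, (projIcc 0 1 h01 t).2, rfl⟩, hqu, ?_, ?_⟩
  · have hvi : ∀ i : Fin 4, ∀ᵐ t ∂volume.restrict (Icc (0 : ℝ) 1), p.v t i = u t i := by
      intro i
      have hInt : IntervalIntegrable (fun t => p.v t i) volume 0 1 :=
        (intervalIntegrable_iff_integrableOn_Icc_of_le h01).2 (p.hvInt i)
      rw [← restrict_Ioo_eq_restrict_Icc]
      filter_upwards [ae_restrict_of_ae hInt.ae_hasDerivAt_integral,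
        ae_restrict_mem measurableSet_Ioo] with t ht hmem
      rw [uIcc_of_le h01] at ht
      have h1 := (ht (Ioo_subset_Icc_self hmem) 0 ⟨le_rfl, h01⟩).const_add (p.q 0 i)
      have hI : Icc (0 : ℝ) 1 ∈ nhds t := Icc_mem_nhds hmem.1 hmem.2
      have h2 := hasDerivAt_pi.1 ((hderiv t (Ioo_subset_Icc_self hmem)).hasDerivAt hI) i
      rw [hud' t (Ioo_subset_Icc_self hmem)]
      exact (h1.congr_of_eventuallyEq (Filter.eventually_of_mem hI fun s hs =>
        p.hrep i s hs)).unique h2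
    filter_upwards [ae_all_iff.2 hvi] with t ht
    exact funext ht
  · intro t
    have ht := (projIcc 0 1 h01 t).2
    have h1 : HasDerivWithinAt (fun s => total (p.q s)) (total (u t)) (Icc (0 : ℝ) 1)
        (projIcc 0 1 h01 t) :=
      total.hasFDerivAt.comp_hasDerivWithinAt _ (hderiv _ ht)
    have h2 : HasDerivWithinAt (fun s => total (p.q s)) 0 (Icc (0 : ℝ) 1)
        (projIcc 0 1 h01 t) :=
      (hasDerivWithinAt_const _ _ (0 : ℝ × ℝ)).congr_of_mem
        (fun s hs => (total_apply _).trans (hchi s hs)) ht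
    exact (hud _ ht).eq_deriv _ h1 h2

lemma hasDerivAt_primitive {f : ℝ → Cfg} (hf : Continuous f) (a t : ℝ) :
    HasDerivAt (fun t => ∫ s in a..t, f s) (f t) t :=
  intervalIntegral.integral_hasDerivAt_right (hf.intervalIntegrable _ _)
    (hf.stronglyMeasurableAtFilter _ _) hf.continuousAt

lemma continuous_primitive' {f : ℝ → Cfg} (hf : Continuous f) (a : ℝ) :
    Continuous fun t => ∫ s in a..t, f s :=
  continuous_iff_continuousAt.2 fun t => (hasDerivAt_primitive hf a t).continuousAt

/-- Integration by parts: the weak form of the Euler-Lagrange equations together with the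
symmetry of the end point condition determines the velocity. -/
lemma velocity_of_stationary {α β : ℝ} {σ : Fin 4 → Fin 4} (h : α ^ 2 + β ^ 2 = 1)
    (hσ : Function.Involutive σ) {u f : ℝ → Cfg} (hu : Continuous u) (hf : Continuous f)
    (hu0 : ∀ t, total (u t) = 0) (hf0 : ∀ t, total (f t) = 0)
    (hstat : ∀ η : ℝ → Cfg, Continuous η → (∀ t, total (η t) = 0) →
      cfgRefl α β σ (∫ t in (0 : ℝ)..1, η t) = ∫ t in (0 : ℝ)..1, η t →
      ∫ t in (0 : ℝ)..1, (dot (u t) (η t) + dot (f t) (∫ s in (0 : ℝ)..t, η s)) = 0) :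
    ∃ m : Cfg, cfgRefl α β σ m = -m ∧
      ∀ t ∈ Icc (0 : ℝ) 1, u t = m + ∫ s in (1 : ℝ)..t, f s := by
  let S := cfgRefl α β σ
  let Γ : ℝ → Cfg := fun t => ∫ s in (1 : ℝ)..t, f s
  let w : ℝ → Cfg := fun t => u t - Γ t
  let W : Cfg := ∫ t in (0 : ℝ)..1, w t
  let m : Cfg := (1 / 2 : ℝ) • (W - S W)
  let η : ℝ → Cfg := fun t => w t - m
  have hΓ : Continuous Γ := continuous_primitive' hf 1
  have hw : Continuous w := hu.sub hΓ
  have hη : Continuous η := hw.sub continuous_const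
  have hΓ0 : ∀ t, total (Γ t) = 0 := fun t => by
    rw [← ContinuousLinearMap.intervalIntegral_comp_comm _ (hf.intervalIntegrable _ _)]
    simp [hf0]
  have hw0 : ∀ t, total (w t) = 0 := fun t => by simp [w, hu0, hΓ0]
  have hW0 : total W = 0 := by
    rw [← ContinuousLinearMap.intervalIntegral_comp_comm _ (hw.intervalIntegrable _ _)]
    simp [hw0]
  have hm0 : total m = 0 := by
    simp [m, S, total_cfgRefl hσ, hW0]
  have hSS : S (S W) = W := cfgRefl_cfgRefl h hσ W
  have hSm : S m = -m := by
    simp only [m, map_smul, map_sub, hSS]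
    rw [← smul_neg, neg_sub]
  have hηint : ∫ t in (0 : ℝ)..1, η t = W - m := by
    rw [intervalIntegral.integral_sub (hw.intervalIntegrable _ _) intervalIntegrable_const]
    simp [W]
  have hWm : W - m = (1 / 2 : ℝ) • (W + S W) := by
    simp only [m]
    module
  have hSfix : S (W - m) = W - m := by
    rw [hWm, map_smul, map_add, hSS, add_comm]
  have horth : dot (W - m) m = 0 := by
    have := dot_cfgRefl h hσ (W - m) m
    change dot (S (W - m)) (S m) = _ at this
    rw [hSfix, hSm, dot_comm, ← neg_one_smul ℝ m, dot_smul_left, dot_comm] at this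
    linarith
  have hparts : ∫ t in (0 : ℝ)..1,
      (dot (f t) (∫ s in (0 : ℝ)..t, η s) + dot (Γ t) (η t)) = 0 := by
    have hξ := continuous_primitive' hη 0
    rw [intervalIntegral.integral_eq_sub_of_hasDerivAt (fun t _ =>
      (hasDerivAt_primitive hf 1 t).dot (hasDerivAt_primitive hη 0 t))]
    · simp [dot]
    · exact (((continuous_dot.comp (hf.prodMk hξ)).add
        (continuous_dot.comp (hΓ.prodMk hη))).intervalIntegrable _ _)
  have hst := hstat η hη (fun t => by simp [η, hw0, hm0]) (by rw [hηint]; exact hSfix)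
  have hξ := continuous_primitive' hη 0
  have hηη : ∫ t in (0 : ℝ)..1, dot (η t) (η t) = 0 := by
    have hsplit : ∀ t, dot (η t) (η t) =
        ((dot (u t) (η t) + dot (f t) (∫ s in (0 : ℝ)..t, η s)) -
        (dot (f t) (∫ s in (0 : ℝ)..t, η s) + dot (Γ t) (η t))) - dot (η t) m := by
      intro t
      have h1 : dot (η t) (η t) + dot m (η t) + dot (Γ t) (η t) = dot (u t) (η t) := by
        rw [← dot_add_left, ← dot_add_left]
        congr 1
        simp only [η, w]
        abel
      rw [dot_comm (η t) m]
      linarith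
    have c1 : Continuous fun t => dot (u t) (η t) + dot (f t) (∫ s in (0 : ℝ)..t, η s) :=
      (continuous_dot.comp (hu.prodMk hη)).add (continuous_dot.comp (hf.prodMk hξ))
    have c2 : Continuous fun t => dot (f t) (∫ s in (0 : ℝ)..t, η s) + dot (Γ t) (η t) :=
      (continuous_dot.comp (hf.prodMk hξ)).add (continuous_dot.comp (hΓ.prodMk hη))
    have c3 : Continuous fun t => dot (η t) m :=
      continuous_dot.comp (hη.prodMk continuous_const)
    have hlast : ∫ t in (0 : ℝ)..1, dot (η t) m = 0 := by
      have := (dotL m).intervalIntegral_comp_comm (hη.intervalIntegrable 0 1) (μ := volume)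
      simp only [dotL_apply] at this
      rw [this, hηint, horth]
    have e1 := intervalIntegral.integral_sub (μ := volume) (c1.intervalIntegrable 0 1)
      (c2.intervalIntegrable 0 1)
    have e2 := intervalIntegral.integral_sub (μ := volume) ((c1.sub c2).intervalIntegrable 0 1)
      (c3.intervalIntegrable 0 1)
    simp only [hsplit]
    refine e2.trans ?_
    rw [hlast, sub_zero]
    exact e1.trans (by rw [hst, hparts, sub_zero])
  have cη : Continuous fun t => dot (η t) (η t) := continuous_dot.comp (hη.prodMk hη)
  have hzero : ∀ t ∈ Icc (0 : ℝ) 1, η t = 0 := by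
    rw [intervalIntegral.integral_eq_zero_iff_of_le_of_nonneg_ae zero_le_one
      (Filter.Eventually.of_forall fun t => dot_self_nonneg _) (cη.intervalIntegrable _ _)] at hηη
    rw [Measure.restrict_congr_set Ioc_ae_eq_Icc] at hηη
    intro t ht
    exact eq_zero_of_dot_self
      (Measure.eqOn_Icc_of_ae_eq volume zero_ne_one hηη cη.continuousOn continuousOn_const ht)
  refine ⟨m, hSm, fun t ht => ?_⟩
  have := hzero t ht
  simp only [η, w, sub_eq_zero] at this
  rw [← this]
  simp [Γ]

/-- The variation `q + ε ξ` of a path, with velocity `u + ε η`, where `ξ` is the primitive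
of `η` vanishing at `0`. -/
def variationPath (q u η : ℝ → Cfg) (hu : Continuous u) (hη : Continuous η)
    (hqu : ∀ t ∈ Icc (0 : ℝ) 1, q t = q 0 + ∫ s in (0 : ℝ)..t, u s) (ε : ℝ) : H1Path4 where
  q t := q t + ε • ∫ s in (0 : ℝ)..t, η s
  v t := u t + ε • η t
  hvInt i := by
    have h : Continuous fun t => (u t + ε • η t) i := by fun_prop
    exact h.continuousOn.integrableOn_compact isCompact_Icc
  hrep i t ht := by
    have h : Continuous fun t => u t + ε • η t := by fun_prop
    have h1 := (ContinuousLinearMap.proj (R := ℝ) (φ := fun _ : Fin 4 => ℝ × ℝ)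
      i).intervalIntegral_comp_comm (h.intervalIntegrable 0 t) (μ := volume)
    simp only [ContinuousLinearMap.proj_apply] at h1
    have h2 : ∫ s in (0 : ℝ)..t, (u s + ε • η s) =
        (∫ s in (0 : ℝ)..t, u s) + ε • ∫ s in (0 : ℝ)..t, η s := by
      rw [← intervalIntegral.integral_smul]
      exact intervalIntegral.integral_add (hu.intervalIntegrable _ _)
        ((hη.const_smul ε).intervalIntegrable _ _)
    rw [h1, h2, hqu t ht]
    simp [add_assoc]
  hL2 i := by
    have h : Continuous fun t => enorm2 ((u t + ε • η t) i) ^ 2 :=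
      (continuous_enorm2.comp (by fun_prop : Continuous fun t => (u t + ε • η t) i)).pow 2
    exact h.continuousOn.integrableOn_compact isCompact_Icc

/-- The first variation of the action vanishes at a minimizer in admissible directions. -/
lemma stationary_of_isMin {E : Set Cfg} {p : H1Path4} (hmin : isMin E p) {q u η : ℝ → Cfg}
    (hq : Continuous q) (hu : Continuous u) (hη : Continuous η)
    (hqp : ∀ t ∈ Icc (0 : ℝ) 1, q t = p.q t)
    (hqu : ∀ t ∈ Icc (0 : ℝ) 1, q t = q 0 + ∫ s in (0 : ℝ)..t, u s)
    (hpv : ∀ᵐ t ∂volume.restrict (Icc (0 : ℝ) 1), p.v t = u t)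
    (hcf : ∀ t ∈ Icc (0 : ℝ) 1, CollisionFree (q t)) (hη0 : ∀ t, total (η t) = 0)
    (hE : ∀ᶠ ε in nhds (0 : ℝ), p.q 1 + ε • ∫ t in (0 : ℝ)..1, η t ∈ E) :
    ∫ t in (0 : ℝ)..1, (dot (u t) (η t) + dot (force (q t)) (∫ s in (0 : ℝ)..t, η s)) = 0 := by
  have hξ := continuous_primitive' hη 0
  refine IsLocalMin.hasDerivAt_eq_zero ?_ (hasDerivAt_action_variation hq hu hξ hη hcf)
  filter_upwards [hE, eventually_collisionFree_variation hq hξ hcf] with ε hεE hεcf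
  let pε := variationPath q u η hu hη hqu ε
  have hadm : inAdm E pε := by
    refine ⟨fun t ht => ?_, ?_, ?_⟩
    · have hξ0 : total (∫ s in (0 : ℝ)..t, η s) = 0 := by
        rw [← ContinuousLinearMap.intervalIntegral_comp_comm _ (hη.intervalIntegrable _ _)]
        simp [hη0]
      have hq0 : total (q t) = 0 := by
        rw [hqp t ht, total_apply]
        exact hmin.1.1 t ht
      rw [← total_apply]
      simp [pε, variationPath, hξ0, hq0]
    · have h0 := hmin.1.2.1
      rw [← hqp 0 ⟨le_rfl, zero_le_one⟩] at h0
      simpa [pε, variationPath] using h0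
    · rw [← hqp 1 ⟨zero_le_one, le_rfl⟩] at hεE
      exact hεE
  have hle := hmin.2 pε hadm
  have huε : Continuous fun t => u t + ε • η t := by fun_prop
  have hqε : Continuous fun t => q t + ε • ∫ s in (0 : ℝ)..t, η s := hq.add (hξ.const_smul ε)
  rw [action_eq_ofReal_integral hq.continuousOn hu.continuousOn
    (fun t ht => (hqp t ht).symm) hpv hcf,
    action_eq_ofReal_integral (p := pε) hqε.continuousOn huε.continuousOn
    (fun t ht => rfl) (Filter.Eventually.of_forall fun t => rfl) hεcf,
    ENNReal.ofReal_le_ofReal_iff (intervalIntegral.integral_nonneg zero_le_one fun t _ =>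
      add_nonneg (mul_nonneg (by norm_num) (dot_self_nonneg _)) (pot_nonneg _))] at hle
  simpa using hle

/-- A twice continuously differentiable curve solving the Newtonian equations. -/
def IsClassicalSolution (Q : ℝ → Cfg) (s : Set ℝ) : Prop :=
  ContDiffOn ℝ 2 Q s ∧ (∀ t ∈ s, CollisionFree (Q t)) ∧ newton Q s

lemma intervalIntegral_reflect {α β : ℝ} {σ : Fin 4 → Fin 4} {g h : ℝ → Cfg} (hg : Continuous g)
    (hgh : ∀ t, h (2 - t) = cfgRefl α β σ (g t)) (t : ℝ) :
    ∫ s in (1 : ℝ)..(2 - t), h s = -cfgRefl α β σ (∫ s in (1 : ℝ)..t, g s) := by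
  have h1 := intervalIntegral.integral_comp_sub_left h 2 (a := t) (b := 1)
  rw [show (2 : ℝ) - 1 = 1 by norm_num] at h1
  rw [← h1, intervalIntegral.integral_symm]
  simp only [hgh]
  rw [ContinuousLinearMap.intervalIntegral_comp_comm _ (hg.intervalIntegrable _ _)]

/-- A solution whose end velocity is reversed by the reflection extends by reflection. -/
lemma isClassicalSolution_reflected {α β : ℝ} {σ : Fin 4 → Fin 4} (h : α ^ 2 + β ^ 2 = 1)
    (hσ : Function.Involutive σ) {q u : ℝ → Cfg} (hq : Continuous q)
    (hu : Continuous u) (hqu : ∀ t ∈ Icc (0 : ℝ) 1, q t = q 0 + ∫ s in (0 : ℝ)..t, u s)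
    (hcf : ∀ t, CollisionFree (q t)) (hfix : cfgRefl α β σ (q 1) = q 1) {m : Cfg}
    (hm : cfgRefl α β σ m = -m)
    (hum : ∀ t ∈ Icc (0 : ℝ) 1, u t = m + ∫ s in (1 : ℝ)..t, force (q s)) {Q : ℝ → Cfg}
    (hQ1 : ∀ t ∈ Icc (0 : ℝ) 1, Q t = q t)
    (hQ2 : ∀ t ∈ Ioo (1 : ℝ) 2, Q t = cfgRefl α β σ (q (2 - t))) :
    IsClassicalSolution Q (Ioo 0 2) := by
  let S := cfgRefl α β σ
  have hSS : ∀ x, S (S x) = x := cfgRefl_cfgRefl h hσ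
  let f : ℝ → Cfg := fun t => force (q t)
  have hf : Continuous f := continuousOn_force.comp_continuous hq hcf
  let F : ℝ → Cfg := fun t => if t ≤ 1 then f t else S (f (2 - t))
  have hFle : ∀ t ≤ 1, F t = f t := fun t ht => if_pos ht
  have hF : Continuous F := by
    refine Continuous.if_le hf (by fun_prop) continuous_id continuous_const ?_
    rintro t rfl
    rw [show (2 : ℝ) - 1 = 1 by norm_num]
    change force (q 1) = S (force (q 1))
    rw [← force_cfgRefl h hσ, hfix]
  have hFrefl : ∀ t, F (2 - t) = S (F t) := by
    intro t
    rcases lt_trichotomy t 1 with ht | rfl | ht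
    · simp only [F]
      rw [if_neg (by linarith), if_pos ht.le, sub_sub_cancel]
    · rw [show (2 : ℝ) - 1 = 1 by norm_num, hFle 1 le_rfl]
      change force (q 1) = S (force (q 1))
      rw [← force_cfgRefl h hσ, hfix]
    · simp only [F]
      rw [if_pos (by linarith : 2 - t ≤ 1), if_neg (not_le.2 ht), hSS]
  let V : ℝ → Cfg := fun t => m + ∫ s in (1 : ℝ)..t, F s
  have hV : ∀ t, HasDerivAt V (F t) t := fun t => (hasDerivAt_primitive hF 1 t).const_add m
  have hVc : Continuous V := continuous_iff_continuousAt.2 fun t => (hV t).continuousAt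
  have hVrefl : ∀ t, -V (2 - t) = S (V t) := by
    intro t
    simp only [V]
    rw [intervalIntegral_reflect hF hFrefl, map_add]
    rw [show S m = -m from hm]
    abel
  let Z : ℝ → Cfg := fun t => q 1 + ∫ s in (1 : ℝ)..t, V s
  have hZ : ∀ t, HasDerivAt Z (V t) t := fun t => (hasDerivAt_primitive hVc 1 t).const_add _
  have hZrefl : ∀ t, Z (2 - t) = S (Z t) := by
    intro t
    have := intervalIntegral_reflect (h := fun t => -V t) hVc hVrefl t
    rw [intervalIntegral.integral_neg, neg_inj] at this
    simp only [Z]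
    rw [this, map_add]
    change _ = S (q 1) + _
    rw [show S (q 1) = q 1 from hfix]
  have hdZ : deriv Z = V := funext fun t => (hZ t).deriv
  have hdV : deriv V = F := funext fun t => (hV t).deriv
  have hZ2 : ContDiff ℝ 2 Z := by
    rw [show (2 : WithTop ℕ∞) = 1 + 1 by norm_num, contDiff_succ_iff_deriv]
    refine ⟨fun t => (hZ t).differentiableAt, by simp, ?_⟩
    rw [hdZ, contDiff_one_iff_deriv, hdV]
    exact ⟨fun t => (hV t).differentiableAt, hF⟩
  have hZq : ∀ t ∈ Icc (0 : ℝ) 1, Z t = q t := by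
    intro t ht
    have h1 : ∫ s in (1 : ℝ)..t, V s = ∫ s in (1 : ℝ)..t, u s := by
      refine intervalIntegral.integral_congr fun s hs => ?_
      rw [uIcc_of_ge ht.2] at hs
      have hs' : s ∈ Icc (0 : ℝ) 1 := ⟨ht.1.trans hs.1, hs.2⟩
      simp only [V]
      rw [hum s hs']
      congr 1
      refine intervalIntegral.integral_congr fun r hr => ?_
      rw [uIcc_of_ge hs.2] at hr
      exact hFle r hr.2
    simp only [Z]
    rw [h1, hqu 1 ⟨zero_le_one, le_rfl⟩, hqu t ht, add_assoc,
      intervalIntegral.integral_add_adjacent_intervals (hu.intervalIntegrable _ _)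
        (hu.intervalIntegrable _ _)]
  have hZQ : ∀ t ∈ Ioo (0 : ℝ) 2, Q t = Z t := by
    intro t ht
    rcases le_or_gt t 1 with h1 | h1
    · rw [hQ1 t ⟨ht.1.le, h1⟩, hZq t ⟨ht.1.le, h1⟩]
    · have := hZrefl (2 - t)
      rw [sub_sub_cancel] at this
      rw [hQ2 t ⟨h1, ht.2⟩, this, hZq (2 - t) ⟨by linarith [ht.2], by linarith⟩]
  refine ⟨hZ2.contDiffOn.congr hZQ, ?_, ?_⟩
  · intro t ht
    rcases le_or_gt t 1 with h1 | h1
    · rw [hQ1 t ⟨ht.1.le, h1⟩]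
      exact hcf t
    · rw [hQ2 t ⟨h1, ht.2⟩]
      exact (hcf _).cfgRefl h hσ
  · intro i t ht
    have hforce : F t = force (Q t) := by
      rcases le_or_gt t 1 with h1 | h1
      · rw [hQ1 t ⟨ht.1.le, h1⟩, hFle t h1]
      · rw [hQ2 t ⟨h1, ht.2⟩, force_cfgRefl h hσ]
        exact if_neg (not_le.2 h1)
    have hnear : (fun s => Q s i) =ᶠ[nhds t] fun s => Z s i :=
      Filter.eventually_of_mem (isOpen_Ioo.mem_nhds ht) fun s hs => congrFun (hZQ s hs) i
    have hd1 : deriv (fun s => Z s i) = fun s => V s i :=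
      funext fun s => (hasDerivAt_pi.1 (hZ s) i).deriv
    rw [hnear.deriv.deriv_eq, hd1, (hasDerivAt_pi.1 (hV t) i).deriv, hforce]
    rfl

/-- An action minimizer of finite action extends by reflection across the end point `t = 1`. -/
theorem isClassicalSolution_of_isMin {α β : ℝ} {σ : Fin 4 → Fin 4} (h : α ^ 2 + β ^ 2 = 1)
    (hσ : Function.Involutive σ) {E : Set Cfg} {p : H1Path4} (hmin : isMin E p)
    (hreg : ContDiffOn ℝ 1 p.q (Icc (0 : ℝ) 1)) (hfin : action p ≠ ⊤)
    (hfix : cfgRefl α β σ (p.q 1) = p.q 1)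
    (hE : ∀ y : Cfg, cfgRefl α β σ y = y → total y = 0 →
      ∀ᶠ ε in nhds (0 : ℝ), p.q 1 + ε • y ∈ E) :
    IsClassicalSolution (fun t => if t ≤ 1 then p.q t else cfgRefl α β σ (p.q (2 - t)))
      (Ioo 0 2) := by
  obtain ⟨q, u, hq, hu, hqp, hrange, hqu, hpv, hu0⟩ := exists_continuous_velocity hreg hmin.1.1
  have hcf : ∀ t, CollisionFree (q t) := fun t => by
    obtain ⟨s, hs, hqs⟩ := hrange t
    rw [hqs]
    exact collisionFree_of_action_ne_top hreg hfin s hs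
  have hf : Continuous fun t => force (q t) := continuousOn_force.comp_continuous hq hcf
  obtain ⟨m, hm, hum⟩ := velocity_of_stationary h hσ hu hf hu0 (fun t => total_force _)
    fun η hη hη0 hηS => stationary_of_isMin hmin hq hu hη hqp hqu hpv (fun t _ => hcf t) hη0
      (hE _ hηS (by
        rw [← ContinuousLinearMap.intervalIntegral_comp_comm _ (hη.intervalIntegrable _ _)]
        simp [hη0]))
  have h1 := hqp 1 ⟨zero_le_one, le_rfl⟩
  refine isClassicalSolution_reflected h hσ hq hu hqu hcf (by rw [h1, hfix]) hm hum ?_ ?_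
  · intro t ht
    rw [if_pos ht.2, hqp t ht]
  · intro t ht
    rw [if_neg (not_le.2 ht.1), hqp (2 - t) ⟨by linarith [ht.2], by linarith [ht.1]⟩]

/-- A collision-free segment between admissible end configurations has finite action. -/
lemma action_ne_top_of_segment {E : Set Cfg} {p : H1Path4} (hmin : isMin E p) {A B : Cfg}
    (hA : A ∈ QSset) (hB : B ∈ E) (hA0 : total A = 0) (hB0 : total B = 0)
    (hcf : ∀ t ∈ Icc (0 : ℝ) 1, CollisionFree (A + t • (B - A))) : action p ≠ ⊤ := by
  let p' := variationPath (fun _ => A) 0 (fun _ => B - A) continuous_zero continuous_const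
    (by simp) 1
  have hq : p'.q = fun t => A + t • (B - A) := by
    funext t
    simp [p', variationPath, smul_sub]
  have hadm : inAdm E p' := by
    refine ⟨fun t ht => ?_, ?_, ?_⟩
    · rw [← total_apply, hq]
      simp [hA0, hB0]
    · rw [hq]
      simpa using hA
    · rw [hq]
      simpa using hB
  have hfin := action_eq_ofReal_integral (p := p') (q := fun t => A + t • (B - A))
    (u := fun _ => B - A) (by fun_prop) continuousOn_const (fun t _ => by rw [hq])
    (Filter.Eventually.of_forall fun t => by simp [p', variationPath]) hcf
  exact ne_top_of_le_ne_top (by rw [hfin]; exact ENNReal.ofReal_ne_top) (hmin.2 p' hadm)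

/-- An initial configuration of `Q_S`. -/
def startCfg : Cfg := ![(-2, 0), (-1, 0), (3 / 2, 1), (3 / 2, -1)]

lemma startCfg_mem : startCfg ∈ QSset :=
  ⟨1, 1, 1, zero_le_one, zero_le_one, by norm_num [startCfg]⟩

/-- The configurations of `Q_{E₁}`, without sign constraints. -/
def endCfg₁ (θ a b c : ℝ) : Cfg :=
  fun i => rotV θ (![(-b, -a), (-c, a), (c, a), (b, -a)] i)

/-- The configurations of `Q_{E₂}`, without sign constraints. -/
def endCfg₂ (θ a b c : ℝ) : Cfg :=
  fun i => rotV θ (![(-a, -b), (-a, b), (a, c), (a, -c)] i)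

/-- Checks that a configuration has no collisions pair by pair. -/
lemma collisionFree_of_lt {x : Cfg} (h01 : x 0 ≠ x 1) (h02 : x 0 ≠ x 2) (h03 : x 0 ≠ x 3)
    (h12 : x 1 ≠ x 2) (h13 : x 1 ≠ x 3) (h23 : x 2 ≠ x 3) : CollisionFree x := by
  intro i j hij
  fin_cases i <;> fin_cases j <;> first | exact absurd rfl hij | assumption | (symm; assumption)

lemma ne_of_fst_lt {v w : ℝ × ℝ} (h : v.1 < w.1) : v ≠ w := fun e => h.ne (congrArg Prod.fst e)

lemma ne_of_snd_lt {v w : ℝ × ℝ} (h : v.2 < w.2) : v ≠ w := fun e => h.ne (congrArg Prod.snd e)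

lemma convex_comb_pos {t a b : ℝ} (ht : t ∈ Icc (0 : ℝ) 1) (ha : 0 < a) (hb : 0 < b) :
    0 < (1 - t) * a + t * b := by
  rcases ht.1.eq_or_lt with rfl | h
  · simpa
  · have := mul_nonneg (sub_nonneg.2 ht.2) ha.le
    have := mul_pos h hb
    linarith

lemma collisionFree_segment₁ {θ : ℝ} (hc : 0 < cos θ) {t : ℝ} (ht : t ∈ Icc (0 : ℝ) 1) :
    CollisionFree (startCfg + t • (endCfg₁ θ 0 2 1 - startCfg)) := by
  have P {a b : ℝ} := convex_comb_pos (a := a) (b := b) ht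
  refine collisionFree_of_lt (ne_of_fst_lt ?_) (ne_of_fst_lt ?_) (ne_of_fst_lt ?_)
    (ne_of_fst_lt ?_) (ne_of_fst_lt ?_) ?_
  · simp only [Pi.add_apply, Pi.smul_apply, Pi.sub_apply]
    simp [startCfg, endCfg₁, rotV]
    linarith [P zero_lt_one hc]
  · simp only [Pi.add_apply, Pi.smul_apply, Pi.sub_apply]
    simp [startCfg, endCfg₁, rotV]
    linarith [P (show (0 : ℝ) < 7 / 2 by norm_num) (mul_pos three_pos hc)]
  · simp only [Pi.add_apply, Pi.smul_apply, Pi.sub_apply]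
    simp [startCfg, endCfg₁, rotV]
    linarith [P (show (0 : ℝ) < 7 / 2 by norm_num) (mul_pos four_pos hc)]
  · simp only [Pi.add_apply, Pi.smul_apply, Pi.sub_apply]
    simp [startCfg, endCfg₁, rotV]
    linarith [P (show (0 : ℝ) < 5 / 2 by norm_num) (mul_pos two_pos hc)]
  · simp only [Pi.add_apply, Pi.smul_apply, Pi.sub_apply]
    simp [startCfg, endCfg₁, rotV]
    linarith [P (show (0 : ℝ) < 5 / 2 by norm_num) (mul_pos three_pos hc)]
  · rcases ht.1.eq_or_lt with rfl | h
    · refine (ne_of_snd_lt ?_).symm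
      simp only [Pi.add_apply, Pi.smul_apply, Pi.sub_apply]
      simp [startCfg, endCfg₁, rotV]
    · refine ne_of_fst_lt ?_
      simp only [Pi.add_apply, Pi.smul_apply, Pi.sub_apply]
      simp [startCfg, endCfg₁, rotV]
      linarith [mul_pos h hc]

lemma collisionFree_segment₂ {θ : ℝ} (hs : 0 < sin θ) (hsc : sin θ < cos θ) {t : ℝ}
    (ht : t ∈ Icc (0 : ℝ) 1) :
    CollisionFree (startCfg + t • (endCfg₂ θ 1 1 1 - startCfg)) := by
  have P {a b : ℝ} := convex_comb_pos (a := a) (b := b) ht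
  have hc : 0 < cos θ := hs.trans hsc
  refine collisionFree_of_lt ?_ (ne_of_fst_lt ?_) (ne_of_fst_lt ?_)
    (ne_of_fst_lt ?_) (ne_of_fst_lt ?_) (ne_of_snd_lt ?_).symm
  · rcases ht.1.eq_or_lt with rfl | h
    · refine ne_of_fst_lt ?_
      simp only [Pi.add_apply, Pi.smul_apply, Pi.sub_apply]
      simp [startCfg, endCfg₂, rotV]
    · refine ne_of_snd_lt ?_
      simp only [Pi.add_apply, Pi.smul_apply, Pi.sub_apply]
      simp [startCfg, endCfg₂, rotV]
      linarith [mul_pos h hc]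
  · simp only [Pi.add_apply, Pi.smul_apply, Pi.sub_apply]
    simp [startCfg, endCfg₂, rotV]
    linarith [P (show (0 : ℝ) < 7 / 2 by norm_num) (sub_pos.2 hsc), mul_nonneg ht.1 hc.le,
      mul_nonneg ht.1 (sub_pos.2 hsc).le]
  · simp only [Pi.add_apply, Pi.smul_apply, Pi.sub_apply]
    simp [startCfg, endCfg₂, rotV]
    linarith [P (show (0 : ℝ) < 7 / 2 by norm_num) hc, mul_nonneg ht.1 hc.le]
  · simp only [Pi.add_apply, Pi.smul_apply, Pi.sub_apply]
    simp [startCfg, endCfg₂, rotV]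
    linarith [P (show (0 : ℝ) < 5 / 2 by norm_num) hc, mul_nonneg ht.1 hc.le]
  · simp only [Pi.add_apply, Pi.smul_apply, Pi.sub_apply]
    simp [startCfg, endCfg₂, rotV]
    linarith [P (show (0 : ℝ) < 5 / 2 by norm_num) hc, mul_nonneg ht.1 hc.le,
      mul_nonneg ht.1 hs.le]
  · simp only [Pi.add_apply, Pi.smul_apply, Pi.sub_apply]
    simp [startCfg, endCfg₂, rotV]
    linarith [P two_pos hc, mul_nonneg ht.1 hc.le]

lemma total_startCfg : total startCfg = 0 := by
  rw [total_apply, Fin.sum_univ_four]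
  ext
  · simp [startCfg]
    norm_num
  · simp [startCfg]

lemma total_endCfg₁ (θ a b c : ℝ) : total (endCfg₁ θ a b c) = 0 := by
  rw [total_apply, Fin.sum_univ_four]
  ext <;> simp [endCfg₁, rotV] <;> ring

lemma total_endCfg₂ (θ a b c : ℝ) : total (endCfg₂ θ a b c) = 0 := by
  rw [total_apply, Fin.sum_univ_four]
  ext <;> simp [endCfg₂, rotV] <;> ring

lemma endCfg₁_add_smul (θ a b c a' b' c' ε : ℝ) :
    endCfg₁ θ a b c + ε • endCfg₁ θ a' b' c' =
      endCfg₁ θ (a + ε * a') (b + ε * b') (c + ε * c') := by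
  funext i
  fin_cases i <;> ext <;> simp [endCfg₁, rotV] <;> ring

lemma endCfg₂_add_smul (θ a b c a' b' c' ε : ℝ) :
    endCfg₂ θ a b c + ε • endCfg₂ θ a' b' c' =
      endCfg₂ θ (a + ε * a') (b + ε * b') (c + ε * c') := by
  funext i
  fin_cases i <;> ext <;> simp [endCfg₂, rotV] <;> ring

lemma planeRefl_rotV (θ : ℝ) (v : ℝ × ℝ) :
    planeRefl (cos (2 * θ)) (sin (2 * θ)) (rotV θ v) = rotV θ (v.1, -v.2) := by
  have h := sin_sq_add_cos_sq θ
  ext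
  · simp only [planeRefl_apply, rotV, cos_two_mul, sin_two_mul]
    linear_combination (2 * v.1 * cos θ) * h
  · simp only [planeRefl_apply, rotV, cos_two_mul, sin_two_mul]
    linear_combination (-2 * v.2 * cos θ) * h

lemma planeRefl_neg (α β : ℝ) (v : ℝ × ℝ) : planeRefl (-α) (-β) v = -planeRefl α β v := by
  ext <;> simp only [planeRefl_apply, Prod.fst_neg, Prod.snd_neg] <;> ring

lemma cfgRefl_endCfg₁ (θ a b c : ℝ) :
    cfgRefl (-cos (2 * θ)) (-sin (2 * θ)) ![3, 2, 1, 0] (endCfg₁ θ a b c) = endCfg₁ θ a b c := by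
  funext i
  rw [cfgRefl_apply, planeRefl_neg, endCfg₁, planeRefl_rotV]
  fin_cases i <;> simp [endCfg₁, rotV] <;> constructor <;> ring

lemma cfgRefl_endCfg₂ (θ a b c : ℝ) :
    cfgRefl (cos (2 * θ)) (sin (2 * θ)) ![1, 0, 3, 2] (endCfg₂ θ a b c) = endCfg₂ θ a b c := by
  funext i
  rw [cfgRefl_apply, endCfg₂, planeRefl_rotV]
  fin_cases i <;> simp [endCfg₂]

lemma exists_eq_endCfg₁ {θ : ℝ} {y : Cfg}
    (hy : cfgRefl (-cos (2 * θ)) (-sin (2 * θ)) ![3, 2, 1, 0] y = y) (h0 : total y = 0) :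
    ∃ a b c, y = endCfg₁ θ a b c := by
  have h := sin_sq_add_cos_sq θ
  rw [total_apply, Fin.sum_univ_four] at h0
  have e0 := congrFun hy 0
  have e1 := congrFun hy 1
  simp only [cfgRefl_apply, planeRefl_apply, cos_two_mul, sin_two_mul, Prod.ext_iff] at e0 e1 h0
  simp at e0 e1 h0
  obtain ⟨e00, e01⟩ := e0
  obtain ⟨e10, e11⟩ := e1
  obtain ⟨f0, f1⟩ := h0
  have k : -sin θ * ((y 2).1 + (y 3).1) + cos θ * ((y 2).2 + (y 3).2) = 0 := by
    rw [← e00, ← e10] at f0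
    rw [← e01, ← e11] at f1
    grind
  refine ⟨(y 3).1 * sin θ - (y 3).2 * cos θ, (y 3).1 * cos θ + (y 3).2 * sin θ,
    (y 2).1 * cos θ + (y 2).2 * sin θ, ?_⟩
  funext i
  fin_cases i <;> ext <;> simp [endCfg₁, rotV] <;> grind

lemma exists_eq_endCfg₂ {θ : ℝ} {y : Cfg}
    (hy : cfgRefl (cos (2 * θ)) (sin (2 * θ)) ![1, 0, 3, 2] y = y) (h0 : total y = 0) :
    ∃ a b c, y = endCfg₂ θ a b c := by
  have h := sin_sq_add_cos_sq θ
  rw [total_apply, Fin.sum_univ_four] at h0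
  have e0 := congrFun hy 0
  have e3 := congrFun hy 3
  simp only [cfgRefl_apply, planeRefl_apply, cos_two_mul, sin_two_mul, Prod.ext_iff] at e0 e3 h0
  simp at e0 e3 h0
  obtain ⟨e00, e01⟩ := e0
  obtain ⟨e30, e31⟩ := e3
  obtain ⟨f0, f1⟩ := h0
  have k : cos θ * ((y 1).1 + (y 2).1) + sin θ * ((y 1).2 + (y 2).2) = 0 := by
    rw [← e00, ← e30] at f0
    rw [← e01, ← e31] at f1
    grind
  refine ⟨-((y 1).1 * cos θ + (y 1).2 * sin θ), -(y 1).1 * sin θ + (y 1).2 * cos θ,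
    -(y 2).1 * sin θ + (y 2).2 * cos θ, ?_⟩
  funext i
  fin_cases i <;> ext <;> simp [endCfg₂, rotV] <;> grind

lemma eventually_endCfg₁_mem {θ : ℝ} {x : Cfg} (hx : x ∈ QE1set θ) (hcf : CollisionFree x)
    {y : Cfg} (hy : cfgRefl (-cos (2 * θ)) (-sin (2 * θ)) ![3, 2, 1, 0] y = y)
    (h0 : total y = 0) : ∀ᶠ ε : ℝ in nhds 0, x + ε • y ∈ QE1set θ := by
  obtain ⟨a, b, c, hb, hc, rfl⟩ := hx
  obtain ⟨a', b', c', rfl⟩ := exists_eq_endCfg₁ hy h0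
  have hb' : 0 < b := hb.lt_of_ne' fun e => hcf 0 3 (by decide) (by simp [e])
  have hc' : 0 < c := hc.lt_of_ne' fun e => hcf 1 2 (by decide) (by simp [e])
  have B : ∀ᶠ ε : ℝ in nhds 0, 0 < b + ε * b' :=
    ContinuousAt.eventually_lt continuousAt_const (by fun_prop) (by simpa)
  have C : ∀ᶠ ε : ℝ in nhds 0, 0 < c + ε * c' :=
    ContinuousAt.eventually_lt continuousAt_const (by fun_prop) (by simpa)
  filter_upwards [B, C] with ε hbε hcε
  exact ⟨_, _, _, hbε.le, hcε.le, endCfg₁_add_smul θ a b c a' b' c' ε⟩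

lemma eventually_endCfg₂_mem {θ : ℝ} {x : Cfg} (hx : x ∈ QE2set θ) (hcf : CollisionFree x)
    {y : Cfg} (hy : cfgRefl (cos (2 * θ)) (sin (2 * θ)) ![1, 0, 3, 2] y = y)
    (h0 : total y = 0) : ∀ᶠ ε : ℝ in nhds 0, x + ε • y ∈ QE2set θ := by
  obtain ⟨a, b, c, hb, hc, rfl⟩ := hx
  obtain ⟨a', b', c', rfl⟩ := exists_eq_endCfg₂ hy h0
  have hb' : 0 < b := hb.lt_of_ne' fun e => hcf 0 1 (by decide) (by simp [e])
  have hc' : 0 < c := hc.lt_of_ne' fun e => hcf 2 3 (by decide) (by simp [e])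
  have B : ∀ᶠ ε : ℝ in nhds 0, 0 < b + ε * b' :=
    ContinuousAt.eventually_lt continuousAt_const (by fun_prop) (by simpa)
  have C : ∀ᶠ ε : ℝ in nhds 0, 0 < c + ε * c' :=
    ContinuousAt.eventually_lt continuousAt_const (by fun_prop) (by simpa)
  filter_upwards [B, C] with ε hbε hcε
  exact ⟨_, _, _, hbε.le, hcε.le, endCfg₂_add_smul θ a b c a' b' c' ε⟩

lemma isClassicalSolution_extension₁ {θ : ℝ} (hθ0 : 0 < θ) (hθ1 : θ < π / 4) {p : H1Path4}
    (hp : isMin (QE1set θ) p) (hreg : ContDiffOn ℝ 1 p.q (Icc (0 : ℝ) 1))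
    (hnc : CollisionFree (p.q 1)) :
    IsClassicalSolution (fun t => if t ≤ 1 then p.q t else
      cfgRefl (-cos (2 * θ)) (-sin (2 * θ)) ![3, 2, 1, 0] (p.q (2 - t))) (Ioo 0 2) := by
  have hc : 0 < cos θ := cos_pos_of_mem_Ioo ⟨by linarith, by linarith⟩
  refine isClassicalSolution_of_isMin (by rw [neg_sq, neg_sq, cos_sq_add_sin_sq])
    (fun i => by fin_cases i <;> rfl) hp hreg ?_ ?_ fun y => eventually_endCfg₁_mem hp.1.2.2 hnc
  · exact action_ne_top_of_segment hp startCfg_mem ⟨0, 2, 1, zero_le_two, zero_le_one, rfl⟩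
      total_startCfg (total_endCfg₁ θ 0 2 1) fun t => collisionFree_segment₁ hc
  · obtain ⟨a, b, c, -, -, h⟩ := hp.1.2.2
    rw [h]
    exact cfgRefl_endCfg₁ θ a b c

lemma isClassicalSolution_extension₂ {θ : ℝ} (hθ0 : 0 < θ) (hθ1 : θ < π / 4) {p : H1Path4}
    (hp : isMin (QE2set θ) p) (hreg : ContDiffOn ℝ 1 p.q (Icc (0 : ℝ) 1))
    (hnc : CollisionFree (p.q 1)) :
    IsClassicalSolution (fun t => if t ≤ 1 then p.q t else
      cfgRefl (cos (2 * θ)) (sin (2 * θ)) ![1, 0, 3, 2] (p.q (2 - t))) (Ioo 0 2) := by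
  have hs : 0 < sin θ := sin_pos_of_pos_of_lt_pi hθ0 (by linarith)
  have hsc : sin θ < cos θ := by
    rw [← sin_pi_div_two_sub]
    exact sin_lt_sin_of_lt_of_le_pi_div_two (by linarith) (by linarith) (by linarith)
  refine isClassicalSolution_of_isMin (cos_sq_add_sin_sq (2 * θ))
    (fun i => by fin_cases i <;> rfl) hp hreg ?_ ?_ fun y => eventually_endCfg₂_mem hp.1.2.2 hnc
  · exact action_ne_top_of_segment hp startCfg_mem ⟨1, 1, 1, zero_le_one, zero_le_one, rfl⟩
      total_startCfg (total_endCfg₂ θ 1 1 1) fun t => collisionFree_segment₂ hs hsc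
  · obtain ⟨a, b, c, -, -, h⟩ := hp.1.2.2
    rw [h]
    exact cfgRefl_endCfg₂ θ a b c

/-- forward extension across `t = 1` (for minimizers over
`P(Q_S,Q_{E₁})` via `q̄ᵢ(t) = −q_{σ(i)}(2−t)·B·R(2θ)` and over `P(Q_S,Q_{E₂})` via
`q̄ᵢ(t) = q̃_{σ'(i)}(2−t)·B·R(2θ)`) yields classical (`C²`, collision-free)
solutions of the Newtonian equations on `(0,2)`. -/
theorem statement6 (θ : ℝ) (hθ0 : 0 < θ) (hθ1 : θ < π/4)
    (p p' : H1Path4) (hp : isMin (QE1set θ) p) (hp' : isMin (QE2set θ) p')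
    (hreg : ContDiffOn ℝ 1 p.q (Icc (0:ℝ) 1))
    (hnewton : newton p.q (Ioo (0:ℝ) 1))
    (hnc : ∀ i j : Fin 4, i ≠ j → p.q 1 i ≠ p.q 1 j)
    (hreg' : ContDiffOn ℝ 1 p'.q (Icc (0:ℝ) 1))
    (hnewton' : newton p'.q (Ioo (0:ℝ) 1))
    (hnc' : ∀ i j : Fin 4, i ≠ j → p'.q 1 i ≠ p'.q 1 j) :
    -- `BR v = v·B·R(2θ)` where `B = diag(1,−1)` acts on row vectors
    let BR : ℝ × ℝ → ℝ × ℝ := fun v => rotV (2*θ) (v.1, -v.2)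
    let τ : Fin 4 → Fin 4 := ![3, 2, 1, 0]
    let τ' : Fin 4 → Fin 4 := ![1, 0, 3, 2]
    let Qbar : ℝ → Fin 4 → ℝ × ℝ := fun t i =>
      if t ≤ 1 then p.q t i else -(BR (p.q (2 - t) (τ i)))
    let Qbar' : ℝ → Fin 4 → ℝ × ℝ := fun t i =>
      if t ≤ 1 then p'.q t i else BR (p'.q (2 - t) (τ' i))
    (ContDiffOn ℝ 2 Qbar (Ioo (0:ℝ) 2) ∧
      (∀ t ∈ Ioo (0:ℝ) 2, ∀ i j : Fin 4, i ≠ j → Qbar t i ≠ Qbar t j) ∧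
      newton Qbar (Ioo (0:ℝ) 2)) ∧
    (ContDiffOn ℝ 2 Qbar' (Ioo (0:ℝ) 2) ∧
      (∀ t ∈ Ioo (0:ℝ) 2, ∀ i j : Fin 4, i ≠ j → Qbar' t i ≠ Qbar' t j) ∧
      newton Qbar' (Ioo (0:ℝ) 2)) := by
  intro BR τ τ' Qbar Qbar'
  have e : Qbar = fun t => if t ≤ 1 then p.q t else
      cfgRefl (-cos (2 * θ)) (-sin (2 * θ)) τ (p.q (2 - t)) := by
    funext t i
    by_cases ht : t ≤ 1
    · simp [Qbar, ht]
    · ext <;> simp [Qbar, BR, ht, rotV, cfgRefl_apply, planeRefl_apply] <;> ring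
  have e' : Qbar' = fun t => if t ≤ 1 then p'.q t else
      cfgRefl (cos (2 * θ)) (sin (2 * θ)) τ' (p'.q (2 - t)) := by
    funext t i
    by_cases ht : t ≤ 1
    · simp [Qbar', ht]
    · ext <;> simp [Qbar', BR, ht, rotV, cfgRefl_apply, planeRefl_apply] <;> ring
  rw [e, e']
  exact ⟨isClassicalSolution_extension₁ hθ0 hθ1 hp hreg hnc,
    isClassicalSolution_extension₂ hθ0 hθ1 hp' hreg' hnc'⟩

end
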